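/- arXiv:2312.08413 — 2 statements merged into one kernel-verified Lean document; each statement's English description precedes it below -/
import Mathlib

section
/- Let T be a binary tree of height h ≥ 1 in which every internal node has exactly two children, every leaf carries a Boolean label (true = favourable, false = unfavourable), and T is pruned, i.e., every internal node whose two children are both leaves has exactly one child labeled favourable and one labeled unfavourable. Then the number of favourable-labeled leaves of T is at most 2^(h−1). -/
/-- A binary tree in which every internal node has exactly two children and
every leaf carries a Boolean label (`true` = favourable). -/
inductive LTree where
  | leaf : Bool → LTree
  | node : LTree → LTree → LTree

/-- The height of the tree: the maximum number of edges on a root-to-leaf path. -/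
def LTree.height : LTree → ℕ
  | .leaf _ => 0
  | .node l r => max l.height r.height + 1

/-- The number of leaves of the tree. -/
def LTree.leaves : LTree → ℕ
  | .leaf _ => 1
  | .node l r => l.leaves + r.leaves

/-- The number of favourable-labeled (`true`) leaves of the tree. -/
def LTree.fav : LTree → ℕ
  | .leaf b => if b then 1 else 0
  | .node l r => l.fav + r.fav

/-- The tree is pruned: every internal node whose two children are both leaves
has exactly one child labeled favourable and one labeled unfavourable. -/
def LTree.Pruned : LTree → Prop
  | .leaf _ => True
  | .node (.leaf a) (.leaf b) => a ≠ b
  | .node l r => l.Pruned ∧ r.Pruned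

/-- For a pruned binary tree of height `h ≥ 1` with Boolean-labeled leaves, the
number of favourable-labeled leaves is at most `2 ^ (h - 1)`. -/
theorem fav_le_pow_of_pruned (t : LTree) (ht : 1 ≤ t.height) (hp : t.Pruned) :
    t.fav ≤ 2 ^ (t.height - 1) := by
  induction t with
  | leaf b => simp [LTree.height] at ht
  | node l r ihl ihr =>
    have hl := Nat.pow_le_pow_right two_pos
      (Nat.sub_le_sub_right (le_max_left l.height r.height) 1)
    have hr := Nat.pow_le_pow_right two_pos
      (Nat.sub_le_sub_right (le_max_right l.height r.height) 1)
    rcases l with a | ⟨l₁, l₂⟩ <;> rcases r with b | ⟨r₁, r₂⟩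
    · cases a <;> cases b <;> simp_all [LTree.Pruned, LTree.fav, LTree.height]
    · have h := ihr (by simp [LTree.height]) hp.2
      have ha : (LTree.leaf a).fav ≤ 1 := by cases a <;> simp [LTree.fav]
      have hpos := Nat.one_le_two_pow (n := (LTree.node r₁ r₂).height - 1)
      simp only [LTree.fav, LTree.height, Nat.zero_le, max_eq_right,
        Nat.add_sub_cancel, pow_succ] at *
      omega
    · have h := ihl (by simp [LTree.height]) hp.1
      have hb : (LTree.leaf b).fav ≤ 1 := by cases b <;> simp [LTree.fav]
      have hpos := Nat.one_le_two_pow (n := (LTree.node l₁ l₂).height - 1)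
      simp only [LTree.fav, LTree.height, Nat.zero_le, max_eq_left,
        Nat.add_sub_cancel, pow_succ] at *
      omega
    · have h₁ := ihl (by simp [LTree.height]) hp.1
      have h₂ := ihr (by simp [LTree.height]) hp.2
      have hmax : max (LTree.node l₁ l₂).height (LTree.node r₁ r₂).height
          = max (LTree.node l₁ l₂).height (LTree.node r₁ r₂).height - 1 + 1 := by
        simp only [LTree.height]
        omega
      change (LTree.node l₁ l₂).fav + (LTree.node r₁ r₂).fav
        ≤ 2 ^ max (LTree.node l₁ l₂).height (LTree.node r₁ r₂).height
      rw [hmax, pow_succ]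
      omega
end

section
/- Let T be a pruned binary tree of height h ≥ 1 with Boolean-labeled leaves that has at least one favourable-labeled leaf, and let Q(T) = F(T) + 1, where F(T) is the number of favourable-labeled leaves of T (Q(T) is the number of histogram queries PAFER issues: one per favourable decision rule plus one for the root). Then 2 ≤ Q(T) ≤ 2^(h−1) + 1, and both bounds are attained: the lower bound by the caterpillar tree of height h and the upper bound by the perfect binary tree of height h with alternating sibling leaf labels. -/
/-- The perfect binary tree of height `h` (every leaf at depth exactly `h`),
with the two leaf children of each depth-`(h-1)` node labeled one favourable
and one unfavourable. -/
def LTree.perfect : ℕ → LTree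
  | 0 => .leaf true
  | 1 => .node (.leaf true) (.leaf false)
  | n + 2 => .node (LTree.perfect (n + 1)) (LTree.perfect (n + 1))

/-- The caterpillar (chain) tree of height `h`: each internal node has one leaf
child labeled unfavourable and one non-leaf child, except the deepest internal
node, whose two leaf children are labeled one favourable and one unfavourable. -/
def LTree.caterpillar : ℕ → LTree
  | 0 => .leaf true
  | 1 => .node (.leaf true) (.leaf false)
  | n + 2 => .node (.leaf false) (LTree.caterpillar (n + 1))

/-- The number of histogram queries PAFER issues for a tree `t`: one per
favourable decision rule (favourable leaf) plus one for the root. -/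
def LTree.queries (t : LTree) : ℕ := t.fav + 1

theorem LTree.pruned_node_iff {l r : LTree} (h : 1 ≤ max l.height r.height) :
    (LTree.node l r).Pruned ↔ l.Pruned ∧ r.Pruned := by
  cases l <;> cases r <;> simp_all [LTree.Pruned, LTree.height]

theorem LTree.fav_le_two_pow {t : LTree} (ht : t.Pruned) : t.fav ≤ 2 ^ (t.height - 1) := by
  induction t with
  | leaf b => cases b <;> simp [LTree.fav, LTree.height]
  | node l r ihl ihr =>
    by_cases hm : 1 ≤ max l.height r.height
    · obtain ⟨hl, hr⟩ := (LTree.pruned_node_iff hm).1 ht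
      have hl' : l.fav ≤ 2 ^ (max l.height r.height - 1) :=
        (ihl hl).trans (Nat.pow_le_pow_right two_pos (by omega))
      have hr' : r.fav ≤ 2 ^ (max l.height r.height - 1) :=
        (ihr hr).trans (Nat.pow_le_pow_right two_pos (by omega))
      obtain ⟨m, hk⟩ := Nat.exists_eq_add_of_le' hm
      simp only [LTree.fav, LTree.height, hk, Nat.add_sub_cancel, pow_succ] at *
      omega
    · cases l with
      | node => simp [LTree.height] at hm
      | leaf a =>
        cases r with
        | node => simp [LTree.height] at hm
        | leaf b => cases a <;> cases b <;> simp_all [LTree.Pruned, LTree.fav, LTree.height]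

theorem LTree.height_caterpillar (n : ℕ) : (LTree.caterpillar n).height = n := by
  fun_induction LTree.caterpillar n <;> simp_all [LTree.height]

theorem LTree.fav_caterpillar (n : ℕ) : (LTree.caterpillar n).fav = 1 := by
  fun_induction LTree.caterpillar n <;> simp_all [LTree.fav]

theorem LTree.pruned_caterpillar (n : ℕ) : (LTree.caterpillar n).Pruned := by
  fun_induction LTree.caterpillar n with
  | case1 => trivial
  | case2 => simp [LTree.Pruned]
  | case3 n ih =>
    exact (LTree.pruned_node_iff (by simp [LTree.height_caterpillar])).2 ⟨trivial, ih⟩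

theorem LTree.height_perfect (n : ℕ) : (LTree.perfect n).height = n := by
  fun_induction LTree.perfect n <;> simp_all [LTree.height]

theorem LTree.fav_perfect (n : ℕ) : (LTree.perfect n).fav = 2 ^ (n - 1) := by
  fun_induction LTree.perfect n <;> simp_all [LTree.fav, pow_succ, mul_two]

theorem LTree.pruned_perfect (n : ℕ) : (LTree.perfect n).Pruned := by
  fun_induction LTree.perfect n with
  | case1 => trivial
  | case2 => simp [LTree.Pruned]
  | case3 n ih =>
    exact (LTree.pruned_node_iff (by simp [LTree.height_perfect])).2 ⟨ih, ih⟩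

/-- For every pruned binary tree `t` of height `h ≥ 1` with at least one
favourable leaf, the number of PAFER queries `Q(t) = F(t) + 1` satisfies
`2 ≤ Q(t) ≤ 2 ^ (h - 1) + 1`; the lower bound is attained by the caterpillar
tree of height `h` and the upper bound by the perfect binary tree of height `h`
with alternating sibling leaf labels. -/
theorem pafer_query_bounds (h : ℕ) (hh : 1 ≤ h) :
    (∀ t : LTree, t.height = h → t.Pruned → 1 ≤ t.fav →
      2 ≤ t.queries ∧ t.queries ≤ 2 ^ (h - 1) + 1) ∧
    ((LTree.caterpillar h).height = h ∧ (LTree.caterpillar h).Pruned ∧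
      1 ≤ (LTree.caterpillar h).fav ∧ (LTree.caterpillar h).queries = 2) ∧
    ((LTree.perfect h).height = h ∧ (LTree.perfect h).Pruned ∧
      1 ≤ (LTree.perfect h).fav ∧ (LTree.perfect h).queries = 2 ^ (h - 1) + 1) := by
  refine ⟨?_, ⟨LTree.height_caterpillar h, LTree.pruned_caterpillar h, ?_, ?_⟩,
    LTree.height_perfect h, LTree.pruned_perfect h, ?_, ?_⟩
  · rintro t rfl ht hf
    exact ⟨Nat.succ_le_succ hf, Nat.succ_le_succ (LTree.fav_le_two_pow ht)⟩
  · rw [LTree.fav_caterpillar]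
  · rw [LTree.queries, LTree.fav_caterpillar]
  · rw [LTree.fav_perfect]
    exact Nat.one_le_two_pow
  · rw [LTree.queries, LTree.fav_perfect]
end
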